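/- arXiv:1802.04615 — 2 statements merged into one kernel-verified Lean document; each statement's English description precedes it below -/
import Mathlib

section
/- Let p = q = 1/2 (symmetric simple random walk). Then E(M_n^+) - sqrt(2n/π) converges to -1/2 as n → ∞. -/
open Finset Filter

/-- The value `±1` of a single step of the walk, driven by a Boolean. -/
def step (b : Bool) : ℤ := if b then 1 else -1

/-- The partial sum `S_j = X_1 + ⋯ + X_j` of the simple random walk driven by `ω`. -/
def walk {n : ℕ} (ω : Fin n → Bool) (j : ℕ) : ℤ :=
  ∑ i ∈ Finset.univ.filter fun i : Fin n => (i : ℕ) < j, step (ω i)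

/-- `M_n^+ = max_{0 ≤ j ≤ n} S_j`. -/
def mplus {n : ℕ} (ω : Fin n → Bool) : ℤ :=
  (Finset.range (n + 1)).sup' (by simp) (walk ω)

/-- `M_n^- = -min_{0 ≤ j ≤ n} S_j`. -/
def mminus {n : ℕ} (ω : Fin n → Bool) : ℤ :=
  -((Finset.range (n + 1)).inf' (by simp) (walk ω))

/-- The probability weight of the path `ω` when `P{Xᵢ = 1} = p`, `P{Xᵢ = -1} = 1 - p`,
independently over `i`. -/
def wt (p : ℝ) {n : ℕ} (ω : Fin n → Bool) : ℝ :=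
  ∏ i, if ω i then p else 1 - p

/-- The probability of an event `A` for a walk of length `n`. -/
noncomputable def prob (p : ℝ) {n : ℕ} (A : Set (Fin n → Bool)) : ℝ :=
  ∑ ω : Fin n → Bool, A.indicator (wt p) ω

/-- The expectation of a functional `f` of a walk of length `n`. -/
noncomputable def expectation (p : ℝ) {n : ℕ} (f : (Fin n → Bool) → ℝ) : ℝ :=
  ∑ ω : Fin n → Bool, wt p ω * f ω

theorem walk_zero {n : ℕ} (ω : Fin n → Bool) : walk ω 0 = 0 := by
  simp [walk]

theorem walk_cons_succ {n : ℕ} (b : Bool) (ω : Fin n → Bool) (j : ℕ) :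
    walk (Fin.cons b ω : Fin (n + 1) → Bool) (j + 1) = step b + walk ω j := by
  simp [walk, Finset.sum_filter, Fin.sum_univ_succ]

theorem walk_le_mplus {n : ℕ} (ω : Fin n → Bool) {j : ℕ} (hj : j ≤ n) :
    walk ω j ≤ mplus ω :=
  Finset.le_sup' (walk ω) (Finset.mem_range.2 (Nat.lt_succ_of_le hj))

theorem mplus_nonneg {n : ℕ} (ω : Fin n → Bool) : 0 ≤ mplus ω := by
  simpa [walk_zero] using walk_le_mplus ω (Nat.zero_le n)

theorem mplus_le_iff {n : ℕ} (ω : Fin n → Bool) (a : ℤ) :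
    mplus ω ≤ a ↔ ∀ j ≤ n, walk ω j ≤ a := by
  simp [mplus, Finset.sup'_le_iff]

/-- The recursion for the maximum obtained by conditioning on the first step. -/
theorem mplus_cons {n : ℕ} (b : Bool) (ω : Fin n → Bool) :
    mplus (Fin.cons b ω : Fin (n + 1) → Bool) = max 0 (step b + mplus ω) := by
  apply le_antisymm
  · rw [mplus_le_iff]
    rintro (_ | j) hj
    · simp [walk_zero]
    · rw [walk_cons_succ]
      have := walk_le_mplus ω (show j ≤ n by omega)
      exact le_max_of_le_right (by omega)
  · refine max_le (mplus_nonneg _) ?_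
    have h : mplus ω ≤ mplus (Fin.cons b ω : Fin (n + 1) → Bool) - step b := by
      rw [mplus_le_iff]
      intro j hj
      have := walk_le_mplus (Fin.cons b ω : Fin (n + 1) → Bool) (show j + 1 ≤ n + 1 by omega)
      rw [walk_cons_succ] at this
      omega
    omega

theorem sum_mplus_succ (n : ℕ) (g : ℤ → ℝ) :
    ∑ ω : Fin (n + 1) → Bool, g (mplus ω) =
      ∑ ω : Fin n → Bool, (g (mplus ω + 1) + g (max 0 (mplus ω - 1))) := by
  rw [← (Fin.consEquiv fun _ : Fin (n + 1) => Bool).sum_comp, Fintype.sum_prod_type,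
    Fintype.sum_bool, ← Finset.sum_add_distrib]
  refine Finset.sum_congr rfl fun ω _ => ?_
  have h := mplus_nonneg ω
  have h1 : max 0 (step true + mplus ω) = mplus ω + 1 := by
    simp only [step, if_true]
    omega
  have h2 : max 0 (step false + mplus ω) = max 0 (mplus ω - 1) := by
    simp only [step, Bool.false_eq_true, if_false]
    omega
  rw [← h1, ← h2, ← mplus_cons, ← mplus_cons]
  rfl

/-- The distribution of the maximum: `M_n^+ = k` for exactly `n.choose ((n + k + 1) / 2)` paths. -/
theorem sum_mplus_eq (n k : ℕ) :
    ∑ ω : Fin n → Bool, (if mplus ω = k then (1 : ℝ) else 0) = n.choose ((n + k + 1) / 2) := by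
  induction n generalizing k with
  | zero =>
    have h : ∀ ω : Fin 0 → Bool, mplus ω = 0 := fun ω => by simp [mplus, walk_zero]
    rcases k with _ | k
    · simp [h]
    · have h1 : Nat.choose 0 ((0 + (k + 1) + 1) / 2) = 0 := Nat.choose_eq_zero_of_lt (by omega)
      rw [h1]
      simp [h]
      omega
  | succ n ih =>
    rw [sum_mplus_succ n fun m => if m = k then (1 : ℝ) else 0]
    rcases k with _ | k
    · have e : (n + 1 + 0 + 1) / 2 = n / 2 + 1 := by omega
      have s : n.choose (n / 2) = n.choose ((n + 0 + 1) / 2) :=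
        Nat.choose_symm_of_eq_add (by omega)
      have e' : (n + 1 + 1) / 2 = n / 2 + 1 := by omega
      rw [e, Nat.choose_succ_succ', Nat.cast_add, s, ← ih 0, ← e', ← ih 1,
        ← Finset.sum_add_distrib]
      refine Finset.sum_congr rfl fun ω _ => ?_
      have h := mplus_nonneg ω
      rcases h.lt_or_eq with h | h
      · by_cases h1 : mplus ω = 1
        · simp [h1]
        · have h2 : ¬ mplus ω ≤ 1 := by omega
          have h3 : mplus ω ≠ 0 := by omega
          have h4 : mplus ω + 1 ≠ 0 := by omega
          simp [h1, h2, h3, h4]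
      · simp [← h]
    · have e : (n + 1 + (k + 1) + 1) / 2 = (n + k + 1) / 2 + 1 := by omega
      have e' : (n + (k + 2) + 1) / 2 = (n + k + 1) / 2 + 1 := by omega
      rw [e, Nat.choose_succ_succ', Nat.cast_add (n.choose _), ← ih k, ← e',
        ← ih (k + 2),
        ← Finset.sum_add_distrib]
      refine Finset.sum_congr rfl fun ω _ => ?_
      have h := mplus_nonneg ω
      have c1 : mplus ω + 1 = ((k + 1 : ℕ) : ℤ) ↔ mplus ω = k := by omega
      have c2 : max 0 (mplus ω - 1) = ((k + 1 : ℕ) : ℤ) ↔ mplus ω = ((k + 2 : ℕ) : ℤ) := by omega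
      simp only [c1, c2]

theorem expectation_half {n : ℕ} (f : (Fin n → Bool) → ℝ) :
    expectation (1 / 2) f = (1 / 2) ^ n * ∑ ω, f ω := by
  have h : ∀ ω : Fin n → Bool, wt (1 / 2) ω = (1 / 2) ^ n := fun ω => by
    have h2 : (1 : ℝ) - 1 / 2 = 1 / 2 := by norm_num
    simp only [wt, h2, ite_self, Finset.prod_const, Finset.card_univ, Fintype.card_fin]
  simp only [expectation, h, Finset.mul_sum]

theorem expectation_mplus_zero :
    expectation (1 / 2) (fun ω : Fin 0 → Bool => (mplus ω : ℝ)) = 0 := by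
  rw [expectation_half]
  simp [mplus, walk_zero]

theorem expectation_mplus_succ (n : ℕ) :
    expectation (1 / 2) (fun ω : Fin (n + 1) → Bool => (mplus ω : ℝ)) =
      expectation (1 / 2) (fun ω : Fin n → Bool => (mplus ω : ℝ)) +
        (1 / 2) ^ (n + 1) * n.choose ((n + 1) / 2) := by
  have h := sum_mplus_eq n 0
  rw [add_zero] at h
  rw [expectation_half, expectation_half, sum_mplus_succ n fun m => (m : ℝ), ← h]
  have h2 : ∀ ω : Fin n → Bool, (((mplus ω + 1 : ℤ) : ℝ) + ((max 0 (mplus ω - 1) : ℤ) : ℝ)) =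
      2 * (mplus ω : ℝ) + if mplus ω = ((0 : ℕ) : ℤ) then 1 else 0 := by
    intro ω
    have h := mplus_nonneg ω
    split_ifs with h0
    · simp [h0]
    · have : max 0 (mplus ω - 1) = mplus ω - 1 := by omega
      rw [this]
      push_cast
      ring
  simp only [h2, Finset.sum_add_distrib, ← Finset.mul_sum]
  ring

/-- The probability that a symmetric walk of length `2 * m` returns to the origin at its end. -/
noncomputable def returnProb (m : ℕ) : ℝ := m.centralBinom / 4 ^ m

theorem returnProb_succ (m : ℕ) :
    (2 * m + 2) * returnProb (m + 1) = (2 * m + 1) * returnProb m := by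
  have h : ((m : ℝ) + 1) * (m + 1).centralBinom = 2 * (2 * m + 1) * m.centralBinom := by
    exact_mod_cast Nat.succ_mul_centralBinom_succ m
  unfold returnProb
  rw [pow_succ]
  field_simp
  linear_combination 2 * h

theorem two_mul_choose_half (m : ℕ) :
    2 * (2 * m + 1).choose (m + 1) = (m + 1).centralBinom := by
  rw [Nat.centralBinom, show 2 * (m + 1) = 2 * m + 1 + 1 by ring, Nat.choose_succ_succ (2 * m + 1) m,
    Nat.choose_symm_half]
  ring

theorem expectation_mplus_two_mul_succ (m : ℕ) :
    expectation (1 / 2) (fun ω : Fin (2 * m + 1) → Bool => (mplus ω : ℝ)) =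
      expectation (1 / 2) (fun ω : Fin (2 * m) → Bool => (mplus ω : ℝ)) + returnProb m / 2 := by
  rw [expectation_mplus_succ, show (2 * m + 1) / 2 = m by omega, returnProb, Nat.centralBinom,
    pow_succ, pow_mul]
  rw [show (1 / 2 : ℝ) ^ 2 = 4⁻¹ by norm_num, inv_pow]
  ring

theorem expectation_mplus_two_mul (m : ℕ) :
    expectation (1 / 2) (fun ω : Fin (2 * m) → Bool => (mplus ω : ℝ)) =
      (2 * m + 1 / 2) * returnProb m - 1 / 2 := by
  induction m with
  | zero =>
    rw [show 2 * 0 = 0 from rfl, expectation_mplus_zero]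
    norm_num [returnProb]
  | succ m ih =>
    have h : (1 / 2 : ℝ) ^ (2 * m + 1 + 1) * (2 * m + 1).choose ((2 * m + 1 + 1) / 2) =
        returnProb (m + 1) / 2 := by
      rw [show (2 * m + 1 + 1) / 2 = m + 1 by omega, returnProb, ← two_mul_choose_half,
        show 2 * m + 1 + 1 = 2 * (m + 1) by ring, pow_mul,
        show (1 / 2 : ℝ) ^ 2 = 4⁻¹ by norm_num, inv_pow]
      push_cast
      ring
    rw [show 2 * (m + 1) = 2 * m + 1 + 1 by ring, expectation_mplus_succ, h,
      expectation_mplus_two_mul_succ, ih]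
    push_cast
    linear_combination -returnProb_succ m

theorem returnProb_nonneg (m : ℕ) : 0 ≤ returnProb m := by
  unfold returnProb
  positivity

theorem returnProb_sq_mul_W (m : ℕ) :
    returnProb m ^ 2 * (2 * m + 1) * Real.Wallis.W m = 1 := by
  have h : (m.centralBinom : ℝ) * (m.factorial : ℝ) ^ 2 = (2 * m).factorial := by
    have := Nat.choose_mul_factorial_mul_factorial (show m ≤ 2 * m by omega)
    rw [show 2 * m - m = m by omega] at this
    rw [Nat.centralBinom, ← this]
    push_cast
    ring
  have hm : (m.factorial : ℝ) ≠ 0 := by positivity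
  have hc : (m.centralBinom : ℝ) ≠ 0 := by exact_mod_cast m.centralBinom_ne_zero
  rw [Real.Wallis.W_eq_factorial_ratio, ← h, returnProb,
    show (2 : ℝ) ^ (4 * m) = (4 ^ m) ^ 2 by rw [← pow_mul, mul_comm m, pow_mul, pow_mul]; norm_num]
  field_simp

theorem le_returnProb_sq (m : ℕ) : 2 ≤ Real.pi * (2 * m + 1) * returnProb m ^ 2 := by
  have h := returnProb_sq_mul_W m
  have h2 : returnProb m ^ 2 * (2 * m + 1) * Real.Wallis.W m ≤
      returnProb m ^ 2 * (2 * m + 1) * (Real.pi / 2) := by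
    gcongr
    exact Real.Wallis.W_le m
  linarith

theorem returnProb_sq_le (m : ℕ) :
    Real.pi * (2 * m + 1) ^ 2 * returnProb m ^ 2 ≤ 2 * (2 * m + 2) := by
  have h := returnProb_sq_mul_W m
  have h2 : returnProb m ^ 2 * (2 * m + 1) * ((2 * m + 1) / (2 * m + 2) * (Real.pi / 2)) ≤ 1 := by
    refine le_trans ?_ h.le
    gcongr
    exact Real.Wallis.le_W m
  rw [← mul_le_mul_iff_of_pos_right (show (0 : ℝ) < 2 * (2 * m + 2) by positivity)] at h2
  field_simp at h2
  linarith

/-- Two-sided bound for `E(M_n^+) + 1/2`. -/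
theorem expectation_mplus_bounds (n : ℕ) :
    0 ≤ expectation (1 / 2) (fun ω : Fin n → Bool => (mplus ω : ℝ)) + 1 / 2 ∧
      2 * n / Real.pi ≤
        (expectation (1 / 2) (fun ω : Fin n → Bool => (mplus ω : ℝ)) + 1 / 2) ^ 2 ∧
      (expectation (1 / 2) (fun ω : Fin n → Bool => (mplus ω : ℝ)) + 1 / 2) ^ 2 ≤
        2 * (n + 2) / Real.pi := by
  have hpi := Real.pi_pos
  rw [div_le_iff₀ hpi, le_div_iff₀ hpi]
  rcases Nat.even_or_odd' n with ⟨m, rfl | rfl⟩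
  · have h0 := returnProb_nonneg m
    have h1 := le_returnProb_sq m
    have h2 := returnProb_sq_le m
    have hq : 0 ≤ Real.pi * returnProb m ^ 2 := by positivity
    rw [expectation_mplus_two_mul, sub_add_cancel]
    push_cast
    refine ⟨by positivity, ?_, ?_⟩
    · nlinarith [mul_le_mul_of_nonneg_left h1 (show (0 : ℝ) ≤ 2 * m by positivity)]
    · have : (0 : ℝ) ≤ m := m.cast_nonneg
      nlinarith [mul_nonneg hq this]
  · have h0 := returnProb_nonneg m
    have h1 := le_returnProb_sq m
    have h2 := returnProb_sq_le m
    have e : (2 * m + 1 / 2) * returnProb m - 1 / 2 + returnProb m / 2 + 1 / 2 =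
        (2 * m + 1) * returnProb m := by ring
    rw [expectation_mplus_two_mul_succ, expectation_mplus_two_mul, e]
    push_cast
    refine ⟨by positivity, ?_, ?_⟩
    · nlinarith [mul_le_mul_of_nonneg_left h1 (show (0 : ℝ) ≤ 2 * m + 1 by positivity)]
    · nlinarith

theorem statement2 :
    Tendsto
      (fun n : ℕ =>
        expectation (1/2) (fun ω : Fin n → Bool => (mplus ω : ℝ)) - Real.sqrt (2 * n / Real.pi))
      atTop (nhds (-(1/2))) := by
  have hs : Tendsto (fun n : ℕ => Real.sqrt (2 * n / Real.pi)) atTop atTop := by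
    refine Real.tendsto_sqrt_atTop.comp (Tendsto.atTop_div_const Real.pi_pos ?_)
    exact tendsto_natCast_atTop_atTop.const_mul_atTop two_pos
  have hd : Tendsto (fun n : ℕ => 4 / Real.pi / Real.sqrt (2 * n / Real.pi)) atTop (nhds 0) :=
    hs.const_div_atTop _
  have key : Tendsto (fun n : ℕ =>
      expectation (1/2) (fun ω : Fin n → Bool => (mplus ω : ℝ)) + 1 / 2 -
        Real.sqrt (2 * n / Real.pi)) atTop (nhds 0) := by
    refine tendsto_of_tendsto_of_tendsto_of_le_of_le' tendsto_const_nhds hd ?_ ?_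
    · refine Eventually.of_forall fun n => ?_
      obtain ⟨h0, h1, -⟩ := expectation_mplus_bounds n
      exact sub_nonneg.2 (Real.sqrt_le_iff.2 ⟨h0, h1⟩)
    · filter_upwards [hs.eventually_gt_atTop 0] with n hn
      obtain ⟨h0, h1, h2⟩ := expectation_mplus_bounds n
      have h3 := Real.sqrt_le_iff.2 ⟨h0, h1⟩
      have hsq := Real.sq_sqrt (show (0 : ℝ) ≤ 2 * n / Real.pi by positivity)
      have e : 2 * ((n : ℝ) + 2) / Real.pi = 2 * n / Real.pi + 4 / Real.pi := by ring
      rw [le_div_iff₀ hn]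
      nlinarith
  have := key.sub_const (1 / 2)
  rw [zero_sub] at this
  exact this.congr fun n => by ring
end

section
/- Let p = q = 1/2 and consider the random walk weakly reflected at the origin: S_0 = 0 and S_j = max(S_{j-1} + X_j, 0) for j ≥ 1, with M_n = max_{0≤j≤n} S_j. Then in the Abel sense E(M_n) ~ sqrt(πn/2); precisely, for every λ ∈ (0,1) the series Σ_{n=1}^∞ λ^n · E(M_n) converges, and lim_{λ → 1⁻} (1 - λ)^{3/2} · Σ_{n=1}^∞ λ^n · E(M_n) = π/(2·sqrt(2)). -/
open Finset Filter

/-- The probability weight of the path `ω` for the symmetric walk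
(`P{Xᵢ = 1} = P{Xᵢ = -1} = 1/2`, independently over `i`). -/
noncomputable def wtHalf {n : ℕ} (_ω : Fin n → Bool) : ℝ :=
  ∏ _i : Fin n, (1/2 : ℝ)

/-- The walk weakly reflected at the origin: `S_0 = 0`, `S_{j+1} = max(S_j + X_{j+1}, 0)`. -/
def walkWeak {n : ℕ} (ω : Fin n → Bool) : ℕ → ℤ
  | 0 => 0
  | j + 1 => max (walkWeak ω j + if h : j < n then step (ω ⟨j, h⟩) else 0) 0

/-- The running maximum `M_n = max_{0 ≤ j ≤ n} S_j` of the weakly reflected walk. -/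
def mWeak {n : ℕ} (ω : Fin n → Bool) : ℤ :=
  (Finset.range (n + 1)).sup' (by simp) (walkWeak ω)

/-- `E(M_n)`, the expected running maximum of the weakly reflected symmetric walk. -/
noncomputable def eMWeak (n : ℕ) : ℝ :=
  ∑ ω : Fin n → Bool, wtHalf ω * (mWeak ω : ℝ)

/-- The weakly reflected walk started from `x`. -/
def walkFrom (x : ℤ) {n : ℕ} (ω : Fin n → Bool) : ℕ → ℤ
  | 0 => x
  | j + 1 => max (walkFrom x ω j + if h : j < n then step (ω ⟨j, h⟩) else 0) 0

lemma walkFrom_zero {n : ℕ} (ω : Fin n → Bool) (j : ℕ) : walkFrom 0 ω j = walkWeak ω j := by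
  induction j with
  | zero => rfl
  | succ j ih => simp only [walkFrom, walkWeak, ih]

lemma walkFrom_cons (x : ℤ) {n : ℕ} (b : Bool) (ω : Fin n → Bool) (j : ℕ) :
    walkFrom x (Fin.cons b ω : Fin (n + 1) → Bool) (j + 1)
      = walkFrom (max (x + step b) 0) ω j := by
  induction j with
  | zero => simp [walkFrom]
  | succ j ih =>
    rw [walkFrom, ih, walkFrom]
    congr 2
    by_cases h : j < n
    · have h' : j + 1 < n + 1 := by omega
      simp only [h, h', dif_pos]
      rfl
    · simp [h]

/-- The probability that the weakly reflected symmetric walk started from `x` reaches the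
level `k` within `n` steps. -/
noncomputable def hitProb (k : ℕ) : ℕ → ℕ → ℝ
  | 0, x => if k ≤ x then 1 else 0
  | n + 1, x => if k ≤ x then 1 else (hitProb k n (x + 1) + hitProb k n (x - 1)) / 2

lemma hitProb_of_le {k x : ℕ} (h : k ≤ x) (n : ℕ) : hitProb k n x = 1 := by
  cases n <;> simp [hitProb, h]

lemma hitProb_nonneg (k n x : ℕ) : 0 ≤ hitProb k n x := by
  induction n generalizing x with
  | zero => rw [hitProb]; split_ifs <;> norm_num
  | succ n ih =>
    rw [hitProb]
    split_ifs
    · norm_num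
    · have := ih (x + 1); have := ih (x - 1); linarith

lemma hitProb_le_one (k n x : ℕ) : hitProb k n x ≤ 1 := by
  induction n generalizing x with
  | zero => rw [hitProb]; split_ifs <;> norm_num
  | succ n ih =>
    rw [hitProb]
    split_ifs
    · norm_num
    · have := ih (x + 1); have := ih (x - 1); linarith

lemma hitProb_eq_zero {k n x : ℕ} (h : x + n < k) : hitProb k n x = 0 := by
  induction n generalizing x with
  | zero => rw [hitProb, if_neg (by omega)]
  | succ n ih =>
    rw [hitProb, if_neg (by omega), ih (by omega), ih (by omega)]
    norm_num

lemma exists_le_walkFrom_cons {k x n : ℕ} (hx : ¬ k ≤ x) (b : Bool) (ω : Fin n → Bool) :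
    (∃ j ≤ n + 1, (k : ℤ) ≤ walkFrom x (Fin.cons b ω : Fin (n + 1) → Bool) j) ↔
      ∃ j ≤ n, (k : ℤ) ≤ walkFrom (max (x + step b) 0) ω j := by
  constructor
  · rintro ⟨j, hj, h⟩
    cases j with
    | zero => simp only [walkFrom] at h; omega
    | succ j => exact ⟨j, by omega, by rwa [walkFrom_cons] at h⟩
  · rintro ⟨j, hj, h⟩
    exact ⟨j + 1, by omega, by rwa [walkFrom_cons]⟩

open Classical in
lemma sum_ite_exists_le_walkFrom (k n x : ℕ) :
    ∑ ω : Fin n → Bool, wtHalf ω * (if ∃ j ≤ n, (k : ℤ) ≤ walkFrom x ω j then (1 : ℝ) else 0)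
      = hitProb k n x := by
  induction n generalizing x with
  | zero => simp [hitProb, walkFrom, wtHalf]
  | succ n ih =>
    by_cases hx : k ≤ x
    · have hω (ω : Fin (n + 1) → Bool) : ∃ j ≤ n + 1, (k : ℤ) ≤ walkFrom x ω j :=
        ⟨0, by omega, by simpa [walkFrom] using hx⟩
      simp only [hω, if_true, hitProb_of_le hx, wtHalf]
      simp
    · rw [hitProb, if_neg hx, ← ih, ← ih,
        ← (Fin.consEquiv (fun _ : Fin (n + 1) => Bool)).sum_comp, Fintype.sum_prod_type,
        Fintype.sum_bool]
      have h1 : max ((x : ℤ) + step true) 0 = ((x + 1 : ℕ) : ℤ) := by simp [step]; omega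
      have h2 : max ((x : ℤ) + step false) 0 = ((x - 1 : ℕ) : ℤ) := by simp [step]; omega
      simp only [Fin.consEquiv, Equiv.coe_fn_mk, exists_le_walkFrom_cons hx, h1, h2]
      simp only [wtHalf, prod_const, card_univ, Fintype.card_fin, ← mul_sum, pow_succ]
      ring

lemma le_mWeak_iff {n : ℕ} (ω : Fin n → Bool) (k : ℤ) :
    k ≤ mWeak ω ↔ ∃ j ≤ n, k ≤ walkFrom 0 ω j := by
  simp only [mWeak, le_sup'_iff, mem_range, walkFrom_zero, Nat.lt_succ_iff]

lemma walkWeak_le {n : ℕ} (ω : Fin n → Bool) (j : ℕ) : walkWeak ω j ≤ j := by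
  induction j with
  | zero => simp [walkWeak]
  | succ j ih =>
    simp only [walkWeak, step]
    split_ifs <;> push_cast <;> omega

lemma mWeak_nonneg {n : ℕ} (ω : Fin n → Bool) : 0 ≤ mWeak ω :=
  (le_mWeak_iff ω 0).2 ⟨0, by omega, le_rfl⟩

lemma mWeak_le {n : ℕ} (ω : Fin n → Bool) : mWeak ω ≤ n := by
  refine sup'_le _ _ fun j hj => (walkWeak_le ω j).trans ?_
  have := mem_range.1 hj
  omega

lemma sum_range_ite_lt {m n : ℕ} (h : m ≤ n) :
    ∑ k ∈ range n, (if k < m then (1 : ℝ) else 0) = m := by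
  rw [sum_boole, show {k ∈ range n | k < m} = range m by ext; simp; omega, card_range]

lemma eMWeak_eq_sum_hitProb (n : ℕ) : eMWeak n = ∑ k ∈ range n, hitProb (k + 1) n 0 := by
  classical
  simp_rw [← sum_ite_exists_le_walkFrom]
  rw [sum_comm]
  refine sum_congr rfl fun ω _ => ?_
  rw [← mul_sum]
  congr 1
  obtain ⟨m, hm⟩ := Int.eq_ofNat_of_zero_le (mWeak_nonneg ω)
  have hmn : m ≤ n := by have := mWeak_le ω; omega
  simp only [Nat.cast_zero, ← le_mWeak_iff, hm]
  rw [Int.cast_natCast, ← sum_range_ite_lt hmn]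
  refine sum_congr rfl fun k _ => ?_
  congr 1
  rw [Nat.cast_le, Nat.succ_le_iff]

lemma summable_pow_mul_hitProb {l : ℝ} (h0 : 0 ≤ l) (h1 : l < 1) (k x : ℕ) :
    Summable fun n => l ^ n * hitProb k n x :=
  (summable_geometric_of_lt_one h0 h1).of_nonneg_of_le
    (fun n => mul_nonneg (pow_nonneg h0 n) (hitProb_nonneg k n x))
    (fun n => mul_le_of_le_one_right (pow_nonneg h0 n) (hitProb_le_one k n x))

lemma tsum_pow_mul_hitProb_of_lt {l : ℝ} (h0 : 0 ≤ l) (h1 : l < 1) {k x : ℕ} (hx : x < k) :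
    ∑' n, l ^ n * hitProb k n x
      = l / 2 * (∑' n, l ^ n * hitProb k n (x + 1) + ∑' n, l ^ n * hitProb k n (x - 1)) := by
  rw [(summable_pow_mul_hitProb h0 h1 k x).tsum_eq_zero_add,
    ← (summable_pow_mul_hitProb h0 h1 k (x + 1)).tsum_add
      (summable_pow_mul_hitProb h0 h1 k (x - 1)), ← tsum_mul_left]
  simp only [hitProb, if_neg (not_le.2 hx), mul_zero, zero_add]
  refine tsum_congr fun n => ?_
  ring

/-- The generating function of the hitting probabilities of level `k` is proportional to
`cosh ((x + 1 / 2) θ)`, where `cosh θ = 1 / l`. -/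
lemma tsum_pow_mul_hitProb_mul_cosh {l θ : ℝ} (h0 : 0 ≤ l) (h1 : l < 1)
    (hθ : l * Real.cosh θ = 1) {k x : ℕ} (hx : x ≤ k) :
    (∑' n, l ^ n * hitProb k n x) * Real.cosh (θ / 2)
      = (∑' n, l ^ n * hitProb k n 0) * Real.cosh ((x + 1 / 2) * θ) := by
  have hl : l ≠ 0 := left_ne_zero_of_mul_eq_one hθ
  induction x using Nat.twoStepInduction with
  | zero => congr 2; push_cast; ring
  | one =>
    have h := tsum_pow_mul_hitProb_of_lt h0 h1 (show 0 < k by omega)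
    have hc : Real.cosh ((((1 : ℕ) : ℝ) + 1 / 2) * θ)
        = 2 * Real.cosh θ * Real.cosh (θ / 2) - Real.cosh (θ / 2) := by
      rw [show (((1 : ℕ) : ℝ) + 1 / 2) * θ = θ + θ / 2 by push_cast; ring,
        Real.cosh_add]
      have := Real.cosh_sub θ (θ / 2)
      rw [show θ - θ / 2 = θ / 2 by ring] at this
      linear_combination this
    rw [hc]
    simp only [zero_add, zero_tsub] at h ⊢
    apply mul_left_cancel₀ hl
    linear_combination (-2 * Real.cosh (θ / 2)) * h
      - 2 * (∑' n, l ^ n * hitProb k n 0) * Real.cosh (θ / 2) * hθ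
  | more x ih0 ih1 =>
    have h := tsum_pow_mul_hitProb_of_lt h0 h1 (show x + 1 < k by omega)
    have hc : Real.cosh (((x + 2 : ℕ) + 1 / 2 : ℝ) * θ)
        = 2 * Real.cosh θ * Real.cosh (((x + 1 : ℕ) + 1 / 2 : ℝ) * θ)
          - Real.cosh ((x + 1 / 2 : ℝ) * θ) := by
      rw [show ((x + 2 : ℕ) + 1 / 2 : ℝ) * θ = ((x + 1 : ℕ) + 1 / 2 : ℝ) * θ + θ by
          push_cast; ring,
        show (x + 1 / 2 : ℝ) * θ = ((x + 1 : ℕ) + 1 / 2 : ℝ) * θ - θ by push_cast; ring,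
        Real.cosh_add, Real.cosh_sub]
      ring
    rw [hc]
    have i0 := ih0 (by omega)
    have i1 := ih1 (by omega)
    simp only [Nat.add_sub_cancel] at h
    apply mul_left_cancel₀ hl
    linear_combination (-2 * Real.cosh (θ / 2)) * h + 2 * i1 - l * i0
      - 2 * (∑' n, l ^ n * hitProb k n 0) * Real.cosh (((x + 1 : ℕ) + 1 / 2 : ℝ) * θ) * hθ

lemma tsum_pow_mul_hitProb_zero {l θ : ℝ} (h0 : 0 ≤ l) (h1 : l < 1)
    (hθ : l * Real.cosh θ = 1) (k : ℕ) :
    ∑' n, l ^ n * hitProb k n 0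
      = Real.cosh (θ / 2) / (1 - l) * (Real.cosh ((k + 1 / 2) * θ))⁻¹ := by
  have h := tsum_pow_mul_hitProb_mul_cosh h0 h1 hθ (le_refl k)
  simp only [hitProb_of_le le_rfl, mul_one, tsum_geometric_of_lt_one h0 h1] at h
  have := (Real.cosh_pos ((k + 1 / 2) * θ)).ne'
  rw [eq_mul_inv_iff_mul_eq₀ this, ← h]
  ring

lemma eMWeak_nonneg (n : ℕ) : 0 ≤ eMWeak n := by
  rw [eMWeak_eq_sum_hitProb]
  exact sum_nonneg fun k _ => hitProb_nonneg _ _ _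

lemma eMWeak_le (n : ℕ) : eMWeak n ≤ n := by
  rw [eMWeak_eq_sum_hitProb]
  simpa using sum_le_card_nsmul (range n) _ 1 fun k _ => hitProb_le_one (k + 1) n 0

lemma summable_pow_mul_eMWeak {l : ℝ} (h0 : 0 ≤ l) (h1 : l < 1) :
    Summable fun n => l ^ n * eMWeak n := by
  have h := summable_pow_mul_geometric_of_norm_lt_one 1
    (show ‖l‖ < 1 by rwa [Real.norm_of_nonneg h0])
  refine h.of_nonneg_of_le (fun n => mul_nonneg (pow_nonneg h0 n) (eMWeak_nonneg n)) fun n => ?_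
  rw [pow_one, mul_comm]
  exact mul_le_mul_of_nonneg_right (eMWeak_le n) (pow_nonneg h0 n)

lemma tsum_pow_mul_eMWeak {l θ : ℝ} (h0 : 0 ≤ l) (h1 : l < 1) (hθ : l * Real.cosh θ = 1) :
    ∑' n, l ^ n * eMWeak n
      = Real.cosh (θ / 2) / (1 - l) * ∑' k : ℕ, (Real.cosh ((k + 3 / 2) * θ))⁻¹ := by
  have hs (n : ℕ) : HasSum (fun k => l ^ n * hitProb (k + 1) n 0) (l ^ n * eMWeak n) := by
    rw [eMWeak_eq_sum_hitProb]
    refine (hasSum_sum_of_ne_finset_zero fun k hk => hitProb_eq_zero ?_).mul_left _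
    simp at hk
    omega
  have hp : Summable fun p : ℕ × ℕ => l ^ p.1 * hitProb (p.2 + 1) p.1 0 := by
    refine (summable_prod_of_nonneg fun p =>
      mul_nonneg (pow_nonneg h0 _) (hitProb_nonneg _ _ _)).2 ⟨fun n => (hs n).summable, ?_⟩
    simpa only [(hs _).tsum_eq] using summable_pow_mul_eMWeak h0 h1
  simp_rw [← (hs _).tsum_eq]
  rw [← Summable.tsum_comm (f := fun n k => l ^ n * hitProb (k + 1) n 0) hp, ← tsum_mul_left]
  refine tsum_congr fun k => ?_
  rw [tsum_pow_mul_hitProb_zero h0 h1 hθ]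
  congr 4
  push_cast
  ring

/-! ### The limit of the series of hyperbolic secants -/

lemma hasDerivAt_arctan_sinh (x : ℝ) :
    HasDerivAt (fun y => Real.arctan (Real.sinh y)) (Real.cosh x)⁻¹ x := by
  convert (Real.hasDerivAt_sinh x).arctan using 1
  have := (Real.cosh_pos x).ne'
  rw [← Real.cosh_sq']
  field_simp

lemma tendsto_arctan_sinh_atTop :
    Tendsto (fun x => Real.arctan (Real.sinh x)) atTop (nhds (Real.pi / 2)) :=
  (Real.tendsto_arctan_atTop.mono_right nhdsWithin_le_nhds).comp
    Real.sinhOrderIso.tendsto_atTop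

lemma exists_arctan_sinh_sub_eq {a b : ℝ} (hab : a < b) :
    ∃ c ∈ Set.Ioo a b,
      Real.arctan (Real.sinh b) - Real.arctan (Real.sinh a) = (b - a) * (Real.cosh c)⁻¹ := by
  obtain ⟨c, hc, h⟩ := exists_hasDerivAt_eq_slope _ _ hab
    (continuous_iff_continuousAt.2 fun x => (hasDerivAt_arctan_sinh x).continuousAt).continuousOn
    fun x _ => hasDerivAt_arctan_sinh x
  refine ⟨c, hc, ?_⟩
  rw [h, mul_div_cancel₀ _ (sub_ne_zero.2 hab.ne')]

lemma inv_cosh_le_inv_cosh {a b : ℝ} (ha : 0 ≤ a) (hab : a ≤ b) :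
    (Real.cosh b)⁻¹ ≤ (Real.cosh a)⁻¹ := by
  refine inv_anti₀ (Real.cosh_pos a) (Real.cosh_le_cosh.2 ?_)
  rwa [abs_of_nonneg ha, abs_of_nonneg (ha.trans hab)]

lemma hasSum_arctan_sinh_sub {θ : ℝ} (hθ : 0 < θ) (a : ℝ) :
    HasSum (fun k : ℕ => Real.arctan (Real.sinh ((k + (a + 1)) * θ))
      - Real.arctan (Real.sinh ((k + a) * θ)))
      (Real.pi / 2 - Real.arctan (Real.sinh (a * θ))) := by
  have hmono (k : ℕ) : 0 ≤ Real.arctan (Real.sinh ((k + (a + 1)) * θ))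
      - Real.arctan (Real.sinh ((k + a) * θ)) := by
    refine sub_nonneg.2 (Real.arctan_mono (Real.sinh_le_sinh.2 ?_))
    nlinarith
  rw [hasSum_iff_tendsto_nat_of_nonneg hmono]
  have h (n : ℕ) := sum_range_sub (fun k : ℕ => Real.arctan (Real.sinh ((k + a) * θ))) n
  simp only [Nat.cast_add, Nat.cast_one, Nat.cast_zero, zero_add, add_assoc, add_comm (1 : ℝ)] at h
  simp only [h]
  refine Tendsto.sub_const (tendsto_arctan_sinh_atTop.comp ?_) _
  exact (tendsto_atTop_add_const_right _ _ tendsto_natCast_atTop_atTop).atTop_mul_const hθ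

lemma theta_mul_tsum_bounds {θ : ℝ} (hθ : 0 < θ) :
    Real.pi / 2 - Real.arctan (Real.sinh (3 / 2 * θ))
        ≤ θ * ∑' k : ℕ, (Real.cosh ((k + 3 / 2) * θ))⁻¹ ∧
      θ * ∑' k : ℕ, (Real.cosh ((k + 3 / 2) * θ))⁻¹
        ≤ Real.pi / 2 - Real.arctan (Real.sinh (1 / 2 * θ)) := by
  have hu (k : ℕ) : θ * (Real.cosh ((k + 3 / 2) * θ))⁻¹
      ≤ Real.arctan (Real.sinh ((k + (1 / 2 + 1)) * θ))
        - Real.arctan (Real.sinh ((k + 1 / 2) * θ)) := by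
    obtain ⟨c, hc, h⟩ := exists_arctan_sinh_sub_eq
      (show ((k : ℝ) + 1 / 2) * θ < (k + (1 / 2 + 1)) * θ by nlinarith)
    have hc0 : 0 ≤ c := le_trans (by positivity) hc.1.le
    rw [h, show ((k : ℝ) + (1 / 2 + 1)) * θ - (k + 1 / 2) * θ = θ by ring]
    refine mul_le_mul_of_nonneg_left (inv_cosh_le_inv_cosh hc0 ?_) hθ.le
    linarith [hc.2]
  have hl (k : ℕ) : Real.arctan (Real.sinh ((k + (3 / 2 + 1)) * θ))
        - Real.arctan (Real.sinh ((k + 3 / 2) * θ))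
      ≤ θ * (Real.cosh ((k + 3 / 2) * θ))⁻¹ := by
    obtain ⟨c, hc, h⟩ := exists_arctan_sinh_sub_eq
      (show ((k : ℝ) + 3 / 2) * θ < (k + (3 / 2 + 1)) * θ by nlinarith)
    rw [h, show ((k : ℝ) + (3 / 2 + 1)) * θ - (k + 3 / 2) * θ = θ by ring]
    exact mul_le_mul_of_nonneg_left (inv_cosh_le_inv_cosh (by positivity) hc.1.le) hθ.le
  have hs : Summable fun k : ℕ => θ * (Real.cosh ((k + 3 / 2) * θ))⁻¹ :=
    (hasSum_arctan_sinh_sub hθ (1 / 2)).summable.of_nonneg_of_le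
      (fun k => mul_nonneg hθ.le (inv_nonneg.2 (Real.cosh_pos _).le)) hu
  rw [← tsum_mul_left]
  exact ⟨hasSum_le hl (hasSum_arctan_sinh_sub hθ _) hs.hasSum,
    hasSum_le hu hs.hasSum (hasSum_arctan_sinh_sub hθ _)⟩

lemma tendsto_mul_tsum_inv_cosh :
    Tendsto (fun θ : ℝ => θ * ∑' k : ℕ, (Real.cosh ((k + 3 / 2) * θ))⁻¹)
      (nhdsWithin 0 (Set.Ioi 0)) (nhds (Real.pi / 2)) := by
  have h (a : ℝ) : Tendsto (fun θ : ℝ => Real.pi / 2 - Real.arctan (Real.sinh (a * θ)))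
      (nhdsWithin 0 (Set.Ioi 0)) (nhds (Real.pi / 2)) := by
    have hc : Continuous fun θ : ℝ => Real.pi / 2 - Real.arctan (Real.sinh (a * θ)) :=
      continuous_const.sub
        (Real.continuous_arctan.comp (Real.continuous_sinh.comp (continuous_const_mul a)))
    simpa using (hc.tendsto 0).mono_left nhdsWithin_le_nhds
  refine tendsto_of_tendsto_of_tendsto_of_le_of_le' (h (3 / 2)) (h (1 / 2)) ?_ ?_ <;>
  filter_upwards [self_mem_nhdsWithin] with θ hθ
  exacts [(theta_mul_tsum_bounds hθ).1, (theta_mul_tsum_bounds hθ).2]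

lemma tendsto_sinh_div_self :
    Tendsto (fun θ : ℝ => Real.sinh θ / θ) (nhdsWithin 0 (Set.Ioi 0)) (nhds 1) := by
  have h := hasDerivAt_iff_tendsto_slope_zero.1 (Real.hasDerivAt_sinh 0)
  simp only [zero_add, Real.sinh_zero, sub_zero, Real.cosh_zero, smul_eq_mul] at h
  simpa only [div_eq_inv_mul] using
    h.mono_left (nhdsWithin_mono 0 fun θ (hθ : θ ∈ Set.Ioi 0) => (Set.mem_Ioi.1 hθ).ne')

/-- The positive solution `θ` of `cosh θ = 1 / l`. -/
noncomputable def coshAngle (l : ℝ) : ℝ := 2 * Real.arsinh (Real.sqrt ((1 - l) / (2 * l)))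

lemma sinh_coshAngle_div_two (l : ℝ) :
    Real.sinh (coshAngle l / 2) = Real.sqrt ((1 - l) / (2 * l)) := by
  rw [coshAngle, mul_div_cancel_left₀ _ two_ne_zero, Real.sinh_arsinh]

lemma mul_cosh_coshAngle {l : ℝ} (h0 : 0 < l) (h1 : l < 1) : l * Real.cosh (coshAngle l) = 1 := by
  have h : 0 ≤ (1 - l) / (2 * l) := div_nonneg (by linarith) (by linarith)
  rw [show coshAngle l = 2 * (coshAngle l / 2) by ring, Real.cosh_two_mul, Real.cosh_sq',
    sinh_coshAngle_div_two, Real.sq_sqrt h]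
  field_simp
  ring

lemma coshAngle_pos {l : ℝ} (h0 : 0 < l) (h1 : l < 1) : 0 < coshAngle l := by
  have h : 0 < (1 - l) / (2 * l) := div_pos (by linarith) (by linarith)
  exact mul_pos two_pos (Real.arsinh_pos_iff.2 (Real.sqrt_pos.2 h))

lemma eventually_mem_Ioo_nhdsLT_one : ∀ᶠ l : ℝ in nhdsWithin 1 (Set.Iio 1), 0 < l ∧ l < 1 :=
  Ioo_mem_nhdsLT zero_lt_one

lemma tendsto_coshAngle :
    Tendsto coshAngle (nhdsWithin 1 (Set.Iio 1)) (nhdsWithin 0 (Set.Ioi 0)) := by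
  refine tendsto_nhdsWithin_iff.2 ⟨?_, ?_⟩
  · have hc : ContinuousAt coshAngle 1 := by
      refine continuousAt_const.mul (Real.continuous_arsinh.continuousAt.comp
        (Real.continuous_sqrt.continuousAt.comp (ContinuousAt.div ?_ ?_ ?_))) <;>
      first | fun_prop | norm_num
    have h : coshAngle 1 = 0 := by simp [coshAngle]
    simpa only [h] using hc.tendsto.mono_left nhdsWithin_le_nhds
  · filter_upwards [eventually_mem_Ioo_nhdsLT_one] with l hl
    exact coshAngle_pos hl.1 hl.2

lemma rpow_mul_tsum_pow_mul_eMWeak {l : ℝ} (h0 : 0 < l) (h1 : l < 1) :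
    (1 - l) ^ ((3 : ℝ) / 2) * ∑' n : ℕ, l ^ (n + 1) * eMWeak (n + 1)
      = Real.sqrt (2 * l) / 2 * (Real.sinh (coshAngle l) / coshAngle l)
        * (coshAngle l * ∑' k : ℕ, (Real.cosh ((k + 3 / 2) * coshAngle l))⁻¹) := by
  have hθ := coshAngle_pos h0 h1
  have hl : 0 < 1 - l := by linarith
  have hsum : ∑' n : ℕ, l ^ (n + 1) * eMWeak (n + 1) = ∑' n, l ^ n * eMWeak n := by
    rw [(summable_pow_mul_eMWeak h0.le h1).tsum_eq_zero_add]
    simp [eMWeak_eq_sum_hitProb 0]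
  have hsqrt : Real.sqrt (1 - l) = Real.sqrt (2 * l) * Real.sinh (coshAngle l / 2) := by
    rw [sinh_coshAngle_div_two, ← Real.sqrt_mul (by linarith)]
    congr 1
    field_simp
  have hsinh : Real.sinh (coshAngle l)
      = 2 * Real.sinh (coshAngle l / 2) * Real.cosh (coshAngle l / 2) := by
    rw [← Real.sinh_two_mul]
    ring_nf
  rw [hsum, tsum_pow_mul_eMWeak h0.le h1 (mul_cosh_coshAngle h0 h1),
    show (3 : ℝ) / 2 = 1 + 1 / 2 by norm_num, Real.rpow_add hl, Real.rpow_one,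
    ← Real.sqrt_eq_rpow, hsqrt, hsinh]
  field_simp

theorem statement19 :
    (∀ l : ℝ, 0 < l → l < 1 →
      Summable fun n : ℕ => l ^ (n + 1) * eMWeak (n + 1)) ∧
    Tendsto
      (fun l : ℝ => (1 - l) ^ ((3 : ℝ) / 2) * ∑' n : ℕ, l ^ (n + 1) * eMWeak (n + 1))
      (nhdsWithin 1 (Set.Iio 1))
      (nhds (Real.pi / (2 * Real.sqrt 2))) := by
  refine ⟨fun l h0 h1 => (summable_nat_add_iff (f := fun n => l ^ n * eMWeak n) 1).2
    (summable_pow_mul_eMWeak h0.le h1), ?_⟩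
  have hsqrt : Tendsto (fun l : ℝ => Real.sqrt (2 * l) / 2) (nhdsWithin 1 (Set.Iio 1))
      (nhds (Real.sqrt (2 * 1) / 2)) :=
    (Continuous.tendsto (by fun_prop) 1).mono_left nhdsWithin_le_nhds
  have h := (hsqrt.mul (tendsto_sinh_div_self.comp tendsto_coshAngle)).mul
    (tendsto_mul_tsum_inv_cosh.comp tendsto_coshAngle)
  have hval : Real.sqrt (2 * 1) / 2 * 1 * (Real.pi / 2) = Real.pi / (2 * Real.sqrt 2) := by
    have h2 : Real.sqrt 2 ^ 2 = 2 := Real.sq_sqrt zero_le_two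
    rw [mul_one, mul_one]
    field_simp
    rw [h2]
  rw [hval] at h
  refine h.congr' ?_
  filter_upwards [eventually_mem_Ioo_nhdsLT_one] with l hl
  exact (rpow_mul_tsum_pow_mul_eMWeak hl.1 hl.2).symm
end
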